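/- arXiv:1809.01719 — 2 statements merged into one kernel-verified Lean document; each statement's English description precedes it below -/
import Mathlib

section
/- Let g(y) = 𝔞·(1 − e^{−βy}) on ℕ with 𝔞, β > 0 (the totally asymmetric q-zero range process with q = e^{−β}), let p = 1, let θ, σ be real numbers with θ + β = σ < ln 𝔞, and let μ̂ = μ^σ. Then the single-shock measure ν_j satisfies the random walking shock property with rates P = (1 − e^{−β})·(𝔞 − e^σ) and Q = 0, i.e. for every bounded cylinder function φ, ∫Lφ dν_j = (1 − e^{−β})(𝔞 − e^σ)·(∫φ dν_{j+1} − ∫φ dν_j). -/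
open MeasureTheory Real

noncomputable def gfact (g : ℕ → ℝ) (z : ℕ) : ℝ := ∏ y ∈ Finset.Icc 1 z, g y

noncomputable def ZN (g : ℕ → ℝ) (θ : ℝ) : ℝ := ∑' z : ℕ, exp (θ * z) / gfact g z

noncomputable def muN (g : ℕ → ℝ) (θ : ℝ) (z : ℕ) : ℝ := exp (θ * z) / (gfact g z * ZN g θ)

abbrev ConfN : Type := ℤ → ℕ

/-- The configuration with one particle moved from site `i` to site `j`. -/
def moveN (η : ConfN) (i j : ℤ) : ConfN :=
  fun k => if k = i then η k - 1 else if k = j then η k + 1 else η k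

/-- The coupled zero range generator with right-jump probability `p` and rate function `g`,
acting on functions of the coupled pair of configurations. -/
noncomputable def LN (p : ℝ) (g : ℕ → ℝ) (φ : ConfN × ConfN → ℝ) (x : ConfN × ConfN) : ℝ :=
  ∑' i : ℤ,
    (p * g (x.1 i) * (φ (moveN x.1 i (i + 1), moveN x.2 i (i + 1)) - φ x)
      + p * (g (x.2 i) - g (x.1 i)) * (φ (x.1, moveN x.2 i (i + 1)) - φ x)
      + (1 - p) * g (x.1 i) * (φ (moveN x.1 i (i - 1), moveN x.2 i (i - 1)) - φ x)
      + (1 - p) * (g (x.2 i) - g (x.1 i)) * (φ (x.1, moveN x.2 i (i - 1)) - φ x))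

/-- A bounded cylinder function: bounded and depending on finitely many coordinates. -/
def IsBddCylinder (φ : ConfN × ConfN → ℝ) : Prop :=
  (∃ s : Finset ℤ, ∀ x y : ConfN × ConfN,
      (∀ i ∈ s, x.1 i = y.1 i ∧ x.2 i = y.2 i) → φ x = φ y)
    ∧ ∃ C : ℝ, ∀ x, |φ x| ≤ C

/-- The discrete measure on ℕ × ℕ with mass function `f`. -/
noncomputable def siteMeasure (f : ℕ × ℕ → ℝ) : Measure (ℕ × ℕ) :=
  Measure.count.withDensity fun yz => ENNReal.ofReal (f yz)

/-- `ν` is the product measure on `(ℕ × ℕ)^ℤ` with the given site marginals: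
every cylinder event has product probability. -/
def IsProductMeasure (fac : ℤ → Measure (ℕ × ℕ)) (ν : Measure (ConfN × ConfN)) : Prop :=
  ∀ (s : Finset ℤ) (B : ℤ → Set (ℕ × ℕ)),
    ν {x : ConfN × ConfN | ∀ i ∈ s, (x.1 i, x.2 i) ∈ B i} = ∏ i ∈ s, fac i (B i)

/-- The site marginals of the single-shock measure `ν_j`: the image of `μ^θ` under
`y ↦ (y,y)` for `i < j`, the image of `μ̂` under `y ↦ (y,y+1)` at `i = j`, and the image of
`μ^σ` under `y ↦ (y,y)` for `i > j`. -/
noncomputable def shockFactor (g : ℕ → ℝ) (θ σ : ℝ) (μhat : ℕ → ℝ) (j i : ℤ) :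
    Measure (ℕ × ℕ) :=
  if i < j then siteMeasure fun yz => if yz.2 = yz.1 then muN g θ yz.1 else 0
  else if i = j then siteMeasure fun yz => if yz.2 = yz.1 + 1 then μhat yz.1 else 0
  else siteMeasure fun yz => if yz.2 = yz.1 then muN g σ yz.1 else 0

/-! ### One-site facts -/

/-- One-site marginal: image of `μ^θ` under `y ↦ (y, y+d)`. -/
noncomputable def mS (g : ℕ → ℝ) (θ : ℝ) (d : ℕ) : Measure (ℕ × ℕ) :=
  siteMeasure fun yz => if yz.2 = yz.1 + d then muN g θ yz.1 else 0

section OneSite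

variable {𝔞 β θ : ℝ} {g : ℕ → ℝ}

lemma g_zero (hg : ∀ y : ℕ, g y = 𝔞 * (1 - exp (-β * y))) : g 0 = 0 := by
  simp [hg]

lemma g_pos (h𝔞 : 0 < 𝔞) (hβ : 0 < β) (hg : ∀ y : ℕ, g y = 𝔞 * (1 - exp (-β * y)))
    (y : ℕ) : 0 < g (y + 1) := by
  rw [hg]
  apply mul_pos h𝔞
  have : exp (-β * ((y + 1 : ℕ) : ℝ)) < 1 := by
    rw [Real.exp_lt_one_iff]
    have : (0 : ℝ) < ((y + 1 : ℕ) : ℝ) := by positivity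
    nlinarith
  linarith

lemma g_abs_le (h𝔞 : 0 < 𝔞) (hβ : 0 < β) (hg : ∀ y : ℕ, g y = 𝔞 * (1 - exp (-β * y)))
    (y : ℕ) : |g y| ≤ 𝔞 := by
  have h1 : exp (-β * (y : ℝ)) ≤ 1 := by
    rw [Real.exp_le_one_iff]
    have : (0 : ℝ) ≤ (y : ℝ) := by positivity
    nlinarith
  have h2 := exp_pos (-β * (y : ℝ))
  rw [hg, abs_le]
  constructor <;> nlinarith

lemma gfact_succ (z : ℕ) : gfact g (z + 1) = gfact g z * g (z + 1) := by
  unfold gfact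
  rw [Finset.prod_Icc_succ_top (by omega)]

lemma gfact_pos (h : ∀ y, 0 < g (y + 1)) (z : ℕ) : 0 < gfact g z := by
  induction z with
  | zero => simp [gfact]
  | succ n ih => rw [gfact_succ]; exact mul_pos ih (h n)

lemma summable_Z (h𝔞 : 0 < 𝔞) (hβ : 0 < β) (hg : ∀ y : ℕ, g y = 𝔞 * (1 - exp (-β * y)))
    (hθ : exp θ < 𝔞) : Summable fun z : ℕ => exp (θ * z) / gfact g z := by
  have hp := g_pos h𝔞 hβ hg
  have hf := gfact_pos hp
  refine summable_of_ratio_test_tendsto_lt_one (l := exp θ / 𝔞) ((div_lt_one h𝔞).2 hθ)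
    (Filter.Eventually.of_forall fun n => (div_pos (exp_pos _) (hf n)).ne') ?_
  have e : ∀ n : ℕ, ‖exp (θ * ((n + 1 : ℕ) : ℝ)) / gfact g (n + 1)‖ / ‖exp (θ * (n : ℝ)) / gfact g n‖
      = exp θ / (𝔞 * (1 - exp (-β) ^ (n + 1))) := by
    intro n
    rw [Real.norm_of_nonneg (div_pos (exp_pos _) (hf _)).le,
      Real.norm_of_nonneg (div_pos (exp_pos _) (hf _)).le, gfact_succ]
    have h1 : g (n + 1) = 𝔞 * (1 - exp (-β) ^ (n + 1)) := by
      rw [hg, ← Real.exp_nat_mul, mul_comm (-β)]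
    rw [← h1]
    have := (hf n).ne'
    have := (hp n).ne'
    have : exp (θ * ((n + 1 : ℕ) : ℝ)) = exp (θ * n) * exp θ := by
      rw [← Real.exp_add]; congr 1; push_cast; ring
    rw [this]
    have := (exp_pos (θ * n)).ne'
    field_simp
  simp_rw [e]
  have h0 : Filter.Tendsto (fun n : ℕ => exp (-β) ^ (n + 1)) Filter.atTop (nhds 0) :=
    (tendsto_pow_atTop_nhds_zero_of_lt_one (exp_pos _).le
      (by rw [Real.exp_lt_one_iff]; linarith)).comp (Filter.tendsto_add_atTop_nat 1)
  have h1 : Filter.Tendsto (fun n : ℕ => exp θ / (𝔞 * (1 - exp (-β) ^ (n + 1)))) Filter.atTop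
      (nhds (exp θ / (𝔞 * (1 - 0)))) :=
    tendsto_const_nhds.div (tendsto_const_nhds.mul (tendsto_const_nhds.sub h0)) (by simpa using h𝔞.ne')
  simpa using h1

lemma ZN_pos (h𝔞 : 0 < 𝔞) (hβ : 0 < β) (hg : ∀ y : ℕ, g y = 𝔞 * (1 - exp (-β * y)))
    (hθ : exp θ < 𝔞) : 0 < ZN g θ := by
  have hf := gfact_pos (g_pos h𝔞 hβ hg)
  exact (summable_Z h𝔞 hβ hg hθ).tsum_pos (fun n => (div_pos (exp_pos _) (hf n)).le) 0
    (div_pos (exp_pos _) (hf 0))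

lemma muN_eq (z : ℕ) : muN g θ z = exp (θ * z) / gfact g z / ZN g θ := by
  unfold muN; rw [div_div]

lemma muN_nonneg (h𝔞 : 0 < 𝔞) (hβ : 0 < β) (hg : ∀ y : ℕ, g y = 𝔞 * (1 - exp (-β * y)))
    (hθ : exp θ < 𝔞) (z : ℕ) : 0 ≤ muN g θ z := by
  have := gfact_pos (g_pos h𝔞 hβ hg) z
  have := ZN_pos h𝔞 hβ hg hθ
  unfold muN; positivity

lemma muN_hasSum (h𝔞 : 0 < 𝔞) (hβ : 0 < β) (hg : ∀ y : ℕ, g y = 𝔞 * (1 - exp (-β * y)))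
    (hθ : exp θ < 𝔞) : HasSum (muN g θ) 1 := by
  have h := (summable_Z h𝔞 hβ hg hθ).hasSum.div_const (ZN g θ)
  have e : (∑' z : ℕ, exp (θ * z) / gfact g z) / ZN g θ = 1 :=
    div_self (ZN_pos h𝔞 hβ hg hθ).ne'
  rw [e] at h
  have e2 : muN g θ = fun z : ℕ => exp (θ * z) / gfact g z / ZN g θ := funext muN_eq
  rw [e2]
  exact h

lemma muN_succ (h𝔞 : 0 < 𝔞) (hβ : 0 < β) (hg : ∀ y : ℕ, g y = 𝔞 * (1 - exp (-β * y)))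
    (z : ℕ) : muN g θ (z + 1) * g (z + 1) = exp θ * muN g θ z := by
  have hp := g_pos h𝔞 hβ hg
  have := (gfact_pos hp z).ne'
  have := (hp z).ne'
  rw [muN_eq, muN_eq, gfact_succ]
  have : exp (θ * ((z + 1 : ℕ) : ℝ)) = exp (θ * z) * exp θ := by
    rw [← Real.exp_add]; congr 1; push_cast; ring
  rw [this]
  field_simp

lemma ZN_ratio {σ : ℝ} (h𝔞 : 0 < 𝔞) (hβ : 0 < β) (hg : ∀ y : ℕ, g y = 𝔞 * (1 - exp (-β * y)))
    (hσ : θ + β = σ) (hσa : exp σ < 𝔞) : 𝔞 * ZN g θ = (𝔞 - exp σ) * ZN g σ := by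
  have hθ : exp θ < 𝔞 := lt_of_le_of_lt (Real.exp_le_exp.2 (by linarith)) hσa
  have hp := g_pos h𝔞 hβ hg
  have hf := gfact_pos hp
  have s1 := summable_Z h𝔞 hβ hg hσa
  have s2 := summable_Z h𝔞 hβ hg hθ
  have h1 : 𝔞 * ZN g σ - 𝔞 * ZN g θ = ∑' z : ℕ, exp (σ * z) / gfact g z * g z := by
    unfold ZN
    rw [← tsum_mul_left, ← tsum_mul_left, ← (s1.mul_left 𝔞).tsum_sub (s2.mul_left 𝔞)]
    congr 1; funext z
    have : exp (θ * (z : ℝ)) = exp (σ * z) * exp (-β * z) := by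
      rw [← Real.exp_add]; congr 1; rw [← hσ]; ring
    rw [this, hg z]; ring
  have h2 : ∑' z : ℕ, exp (σ * z) / gfact g z * g z = exp σ * ZN g σ := by
    have e : ∀ z : ℕ, exp (σ * ((z + 1 : ℕ) : ℝ)) / gfact g (z + 1) * g (z + 1)
        = exp σ * (exp (σ * z) / gfact g z) := by
      intro z
      have := (hf z).ne'
      have := (hp z).ne'
      have : exp (σ * ((z + 1 : ℕ) : ℝ)) = exp (σ * z) * exp σ := by
        rw [← Real.exp_add]; congr 1; push_cast; ring
      rw [this, gfact_succ]
      field_simp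
    rw [tsum_eq_zero_add' (by simp_rw [e]; exact s1.mul_left _)]
    simp_rw [e]
    rw [tsum_mul_left, g_zero hg]
    simp [ZN]
  linarith

lemma muN_shift {σ : ℝ} (h𝔞 : 0 < 𝔞) (hβ : 0 < β) (hg : ∀ y : ℕ, g y = 𝔞 * (1 - exp (-β * y)))
    (hσ : θ + β = σ) (hσa : exp σ < 𝔞) (y : ℕ) :
    muN g σ y * (g (y + 1) - g y) = (1 - exp (-β)) * (𝔞 - exp σ) * muN g θ y := by
  have hθ : exp θ < 𝔞 := lt_of_le_of_lt (Real.exp_le_exp.2 (by linarith)) hσa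
  have z1 := (ZN_pos h𝔞 hβ hg hσa).ne'
  have z2 := (ZN_pos h𝔞 hβ hg hθ).ne'
  have hf := (gfact_pos (g_pos h𝔞 hβ hg) y).ne'
  have hr := ZN_ratio h𝔞 hβ hg hσ hσa
  have e1 : g (y + 1) - g y = 𝔞 * exp (-β * y) * (1 - exp (-β)) := by
    have : exp (-β * ((y + 1 : ℕ) : ℝ)) = exp (-β * y) * exp (-β) := by
      rw [← Real.exp_add]; congr 1; push_cast; ring
    rw [hg, hg, this]; ring
  have e2 : exp (θ * (y : ℝ)) = exp (σ * y) * exp (-β * y) := by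
    rw [← Real.exp_add]; congr 1; rw [← hσ]; ring
  rw [e1, muN_eq, muN_eq, e2]
  field_simp
  linear_combination (1 - exp (-β)) * hr

lemma siteMeasure_singleton (f : ℕ × ℕ → ℝ) (a : ℕ × ℕ) :
    siteMeasure f {a} = ENNReal.ofReal (f a) := by
  unfold siteMeasure
  rw [withDensity_apply _ (measurableSet_singleton a)]
  simp

lemma mS_eq_map (d : ℕ) : mS g θ d =
    (Measure.count.withDensity fun y => ENNReal.ofReal (muN g θ y)).map (fun y : ℕ => (y, y + d)) := by
  refine Measure.ext_of_singleton fun a => ?_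
  rw [mS, siteMeasure_singleton, Measure.map_apply (by fun_prop) (measurableSet_singleton a)]
  obtain ⟨a, b⟩ := a
  by_cases h : b = a + d
  · have : (fun y : ℕ => (y, y + d)) ⁻¹' {(a, b)} = {a} := by
      ext y; simp; omega
    rw [this, withDensity_apply _ (measurableSet_singleton a)]
    simp [h]
  · have : (fun y : ℕ => (y, y + d)) ⁻¹' {(a, b)} = ∅ := by
      ext y; simp; omega
    rw [this]
    simp [h]

lemma mS_prob (h𝔞 : 0 < 𝔞) (hβ : 0 < β) (hg : ∀ y : ℕ, g y = 𝔞 * (1 - exp (-β * y)))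
    (hθ : exp θ < 𝔞) (d : ℕ) : IsProbabilityMeasure (mS g θ d) := by
  have : IsProbabilityMeasure (Measure.count.withDensity fun y => ENNReal.ofReal (muN g θ y)) := by
    constructor
    rw [withDensity_apply _ MeasurableSet.univ, Measure.restrict_univ, lintegral_count,
      ← ENNReal.ofReal_tsum_of_nonneg (muN_nonneg h𝔞 hβ hg hθ) (muN_hasSum h𝔞 hβ hg hθ).summable,
      (muN_hasSum h𝔞 hβ hg hθ).tsum_eq]
    simp
  rw [mS_eq_map]
  exact Measure.isProbabilityMeasure_map (by fun_prop)

lemma mS_integral (h𝔞 : 0 < 𝔞) (hβ : 0 < β) (hg : ∀ y : ℕ, g y = 𝔞 * (1 - exp (-β * y)))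
    (hθ : exp θ < 𝔞) (d : ℕ) (F : ℕ × ℕ → ℝ) (hF : ∃ C, ∀ y, |F y| ≤ C) :
    ∫ y, F y ∂(mS g θ d) = ∑' y : ℕ, muN g θ y * F (y, y + d) := by
  obtain ⟨C, hC⟩ := hF
  have hp := mS_prob h𝔞 hβ hg hθ d
  have hi : Integrable F (mS g θ d) :=
    Integrable.of_bound (measurable_of_countable F).aestronglyMeasurable C
      (Filter.Eventually.of_forall hC)
  rw [mS_eq_map] at hi ⊢
  rw [integral_map (by fun_prop) hi.aestronglyMeasurable]
  have hi' := hi.comp_measurable (f := fun y : ℕ => (y, y + d)) (by fun_prop)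
  refine (integral_countable hi').trans ?_
  congr 1; funext y
  rw [Measure.real, withDensity_apply _ (measurableSet_singleton y)]
  simp [ENNReal.toReal_ofReal (muN_nonneg h𝔞 hβ hg hθ y)]

lemma muN_summable_mul (h𝔞 : 0 < 𝔞) (hβ : 0 < β) (hg : ∀ y : ℕ, g y = 𝔞 * (1 - exp (-β * y)))
    (hθ : exp θ < 𝔞) (F : ℕ → ℝ) (hF : ∃ C, ∀ y, |F y| ≤ C) :
    Summable fun y => muN g θ y * F y := by
  obtain ⟨C, hC⟩ := hF
  refine Summable.of_norm_bounded ((muN_hasSum h𝔞 hβ hg hθ).summable.mul_right C) fun y => ?_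
  rw [norm_mul, Real.norm_of_nonneg (muN_nonneg h𝔞 hβ hg hθ y)]
  exact mul_le_mul_of_nonneg_left (hC y) (muN_nonneg h𝔞 hβ hg hθ y)

/-- integration by parts at one site -/
lemma mS_inc (h𝔞 : 0 < 𝔞) (hβ : 0 < β) (hg : ∀ y : ℕ, g y = 𝔞 * (1 - exp (-β * y)))
    (hθ : exp θ < 𝔞) (d : ℕ) (F : ℕ × ℕ → ℝ) (hF : ∃ C, ∀ y, |F y| ≤ C) :
    ∫ y, exp θ * F (y.1 + 1, y.2 + 1) ∂(mS g θ d) = ∫ y, g y.1 * F y ∂(mS g θ d) := by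
  obtain ⟨C, hC⟩ := hF
  rw [mS_integral h𝔞 hβ hg hθ, mS_integral h𝔞 hβ hg hθ]
  · have e : ∀ y : ℕ, muN g θ (y + 1) * (g (y + 1) * F (y + 1, y + 1 + d))
        = muN g θ y * (exp θ * F (y + 1, y + d + 1)) := by
      intro y
      rw [← mul_assoc, muN_succ h𝔞 hβ hg, show y + 1 + d = y + d + 1 by ring]; ring
    rw [tsum_eq_zero_add' (f := fun y => muN g θ y * (g y * F (y, y + d)))]
    · simp only [e, g_zero hg]
      simp
    · simp only [e]
      refine muN_summable_mul h𝔞 hβ hg hθ _ ⟨exp θ * C, fun y => ?_⟩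
      rw [abs_mul, abs_of_pos (exp_pos θ)]
      exact mul_le_mul_of_nonneg_left (hC _) (exp_pos θ).le
  · refine ⟨𝔞 * C, fun y => ?_⟩
    rw [abs_mul]
    exact mul_le_mul (g_abs_le h𝔞 hβ hg _) (hC _) (abs_nonneg _) h𝔞.le
  · refine ⟨exp θ * C, fun y => ?_⟩
    rw [abs_mul, abs_of_pos (exp_pos θ)]
    exact mul_le_mul_of_nonneg_left (hC _) (exp_pos θ).le

lemma mS_dec (h𝔞 : 0 < 𝔞) (hβ : 0 < β) (hg : ∀ y : ℕ, g y = 𝔞 * (1 - exp (-β * y)))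
    (hθ : exp θ < 𝔞) (d : ℕ) (F : ℕ × ℕ → ℝ) (hF : ∃ C, ∀ y, |F y| ≤ C) :
    ∫ y, g y.1 * F (y.1 - 1, y.2 - 1) ∂(mS g θ d) = ∫ y, exp θ * F y ∂(mS g θ d) := by
  have := mS_inc h𝔞 hβ hg hθ d (fun y => F (y.1 - 1, y.2 - 1))
    (by obtain ⟨C, hC⟩ := hF; exact ⟨C, fun y => hC _⟩)
  rw [← this]
  simp

lemma mS_jump {σ : ℝ} (h𝔞 : 0 < 𝔞) (hβ : 0 < β) (hg : ∀ y : ℕ, g y = 𝔞 * (1 - exp (-β * y)))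
    (hσ : θ + β = σ) (hσa : exp σ < 𝔞) (F : ℕ × ℕ → ℝ) (hF : ∃ C, ∀ y, |F y| ≤ C) :
    ∫ y, (g y.2 - g y.1) * F (y.1, y.2 - 1) ∂(mS g σ 1)
      = ∫ y, ((1 - exp (-β)) * (𝔞 - exp σ)) * F y ∂(mS g θ 0) := by
  have hθ : exp θ < 𝔞 := lt_of_le_of_lt (Real.exp_le_exp.2 (by linarith)) hσa
  obtain ⟨C, hC⟩ := hF
  rw [mS_integral h𝔞 hβ hg hσa, mS_integral h𝔞 hβ hg hθ]
  · congr 1; funext y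
    have := muN_shift h𝔞 hβ hg hσ hσa y
    simp only [add_tsub_cancel_right, add_zero]
    rw [← mul_assoc, this]; ring
  · refine ⟨|(1 - exp (-β)) * (𝔞 - exp σ)| * C, fun y => ?_⟩
    rw [abs_mul]
    exact mul_le_mul_of_nonneg_left (hC _) (abs_nonneg _)
  · refine ⟨(𝔞 + 𝔞) * C, fun y => ?_⟩
    rw [abs_mul]
    refine mul_le_mul ?_ (hC _) (abs_nonneg _) (by positivity)
    exact (abs_sub _ _).trans (add_le_add (g_abs_le h𝔞 hβ hg _) (g_abs_le h𝔞 hβ hg _))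

lemma mS_raise (h𝔞 : 0 < 𝔞) (hβ : 0 < β) (hg : ∀ y : ℕ, g y = 𝔞 * (1 - exp (-β * y)))
    (hθ : exp θ < 𝔞) (F : ℕ × ℕ → ℝ) (hF : ∃ C, ∀ y, |F y| ≤ C) :
    ∫ y, F (y.1, y.2 + 1) ∂(mS g θ 0) = ∫ y, F y ∂(mS g θ 1) := by
  obtain ⟨C, hC⟩ := hF
  rw [mS_integral h𝔞 hβ hg hθ _ _ ⟨C, fun y => hC _⟩, mS_integral h𝔞 hβ hg hθ _ _ ⟨C, hC⟩]
  simp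

lemma mS_diag (h𝔞 : 0 < 𝔞) (hβ : 0 < β) (hg : ∀ y : ℕ, g y = 𝔞 * (1 - exp (-β * y)))
    (hθ : exp θ < 𝔞) (F : ℕ × ℕ → ℝ) (hF : ∃ C, ∀ y, |F y| ≤ C) :
    ∫ y, (g y.2 - g y.1) * F y ∂(mS g θ 0) = 0 := by
  obtain ⟨C, hC⟩ := hF
  rw [mS_integral h𝔞 hβ hg hθ]
  · simp
  · refine ⟨(𝔞 + 𝔞) * C, fun y => ?_⟩
    rw [abs_mul]
    refine mul_le_mul ?_ (hC _) (abs_nonneg _) (by positivity)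
    exact (abs_sub _ _).trans (add_le_add (g_abs_le h𝔞 hβ hg _) (g_abs_le h𝔞 hβ hg _))

lemma mS_second (h𝔞 : 0 < 𝔞) (hβ : 0 < β) (hg : ∀ y : ℕ, g y = 𝔞 * (1 - exp (-β * y)))
    (hθ : exp θ < 𝔞) (F : ℕ × ℕ → ℝ) (hF : ∃ C, ∀ y, |F y| ≤ C) :
    ∫ y, g y.2 * F y ∂(mS g θ 1)
      = ∫ y, (exp (-β) * g y.1 + 𝔞 * (1 - exp (-β))) * F y ∂(mS g θ 1) := by
  obtain ⟨C, hC⟩ := hF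
  rw [mS_integral h𝔞 hβ hg hθ, mS_integral h𝔞 hβ hg hθ]
  · congr 1; funext y
    have : exp (-β * ((y + 1 : ℕ) : ℝ)) = exp (-β * y) * exp (-β) := by
      rw [← Real.exp_add]; congr 1; push_cast; ring
    simp only [hg, this]; ring
  · refine ⟨(exp (-β) * 𝔞 + |𝔞 * (1 - exp (-β))|) * C, fun y => ?_⟩
    rw [abs_mul]
    refine mul_le_mul ?_ (hC _) (abs_nonneg _) (by positivity)
    refine (abs_add_le _ _).trans (add_le_add ?_ le_rfl)
    rw [abs_mul, abs_of_pos (exp_pos _)]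
    exact mul_le_mul_of_nonneg_left (g_abs_le h𝔞 hβ hg _) (exp_pos _).le
  · refine ⟨𝔞 * C, fun y => ?_⟩
    rw [abs_mul]
    exact mul_le_mul (g_abs_le h𝔞 hβ hg _) (hC _) (abs_nonneg _) h𝔞.le

end OneSite

/-! ### Product measures -/

/-- Bounded measurable. -/
def BM (F : (ℤ → ℕ × ℕ) → ℝ) : Prop := Measurable F ∧ ∃ C, ∀ u, |F u| ≤ C

/-- modify one coordinate -/
def upd (k : ℤ) (t : ℕ × ℕ → ℕ × ℕ) (u : ℤ → ℕ × ℕ) : ℤ → ℕ × ℕ :=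
  Function.update u k (t (u k))

lemma measurable_upd (k : ℤ) (t : ℕ × ℕ → ℕ × ℕ) : Measurable (upd k t) := by
  refine measurable_pi_iff.2 fun i => ?_
  by_cases h : i = k
  · subst h
    simp only [upd, Function.update_self]
    exact (measurable_of_countable t).comp (measurable_pi_apply i)
  · simp only [upd, Function.update_of_ne h]
    exact measurable_pi_apply i

lemma BM.upd {F : (ℤ → ℕ × ℕ) → ℝ} (hF : BM F) (k : ℤ) (t : ℕ × ℕ → ℕ × ℕ) :
    BM fun u => F (upd k t u) :=
  ⟨hF.1.comp (measurable_upd k t), hF.2.imp fun _ h _ => h _⟩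

lemma BM.mul {F G : (ℤ → ℕ × ℕ) → ℝ} (hF : BM F) (hG : BM G) : BM fun u => F u * G u := by
  obtain ⟨h1, C, hC⟩ := hF
  obtain ⟨h2, D, hD⟩ := hG
  refine ⟨h1.mul h2, C * D, fun u => ?_⟩
  rw [abs_mul]
  exact mul_le_mul (hC u) (hD u) (abs_nonneg _) ((abs_nonneg _).trans (hC u))

lemma BM.add {F G : (ℤ → ℕ × ℕ) → ℝ} (hF : BM F) (hG : BM G) : BM fun u => F u + G u := by
  obtain ⟨h1, C, hC⟩ := hF
  obtain ⟨h2, D, hD⟩ := hG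
  exact ⟨h1.add h2, C + D, fun u => (abs_add_le _ _).trans (add_le_add (hC u) (hD u))⟩

lemma BM.sub {F G : (ℤ → ℕ × ℕ) → ℝ} (hF : BM F) (hG : BM G) : BM fun u => F u - G u := by
  obtain ⟨h1, C, hC⟩ := hF
  obtain ⟨h2, D, hD⟩ := hG
  exact ⟨h1.sub h2, C + D, fun u => (abs_sub _ _).trans (add_le_add (hC u) (hD u))⟩

lemma BM.site (w : ℕ × ℕ → ℝ) (hw : ∃ C, ∀ y, |w y| ≤ C) (k : ℤ) : BM fun u => w (u k) :=
  ⟨(measurable_of_countable w).comp (measurable_pi_apply k), hw.imp fun _ h _ => h _⟩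

lemma BM.integrable {F : (ℤ → ℕ × ℕ) → ℝ} (hF : BM F) (μ : Measure (ℤ → ℕ × ℕ))
    [IsProbabilityMeasure μ] : Integrable F μ := by
  obtain ⟨h1, C, hC⟩ := hF
  exact Integrable.of_bound h1.aestronglyMeasurable C (Filter.Eventually.of_forall hC)

lemma measurable_update2 (k : ℤ) :
    Measurable fun p : (ℤ → ℕ × ℕ) × (ℕ × ℕ) => Function.update p.1 k p.2 := by
  refine measurable_pi_iff.2 fun i => ?_
  by_cases h : i = k
  · subst h
    simp only [Function.update_self]
    exact measurable_snd
  · simp only [Function.update_of_ne h]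
    exact (measurable_pi_apply i).comp measurable_fst

lemma map_update (fac : ℤ → Measure (ℕ × ℕ)) [∀ i, IsProbabilityMeasure (fac i)] (k : ℤ)
    (m : Measure (ℕ × ℕ)) [IsProbabilityMeasure m]
    [∀ i, IsProbabilityMeasure (Function.update fac k m i)] :
    ((Measure.infinitePi fac).prod m).map (fun p => Function.update p.1 k p.2)
      = Measure.infinitePi (Function.update fac k m) := by
  refine Measure.eq_infinitePi _ fun s t ht => ?_
  rw [Measure.map_apply (measurable_update2 k) (MeasurableSet.pi s.countable_toSet fun i _ => ht i)]
  have e : (fun p : (ℤ → ℕ × ℕ) × (ℕ × ℕ) => Function.update p.1 k p.2) ⁻¹' (Set.pi s t)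
      = (Set.pi (↑(s.erase k)) t) ×ˢ (if k ∈ s then t k else Set.univ) := by
    ext p
    simp only [Set.mem_preimage, Set.mem_pi, Set.mem_prod, Finset.coe_erase, Set.mem_sdiff,
      Finset.mem_coe, Set.mem_singleton_iff]
    constructor
    · intro h
      refine ⟨fun i hi => ?_, ?_⟩
      · have := h i hi.1
        rwa [Function.update_of_ne hi.2] at this
      · split_ifs with hk
        · have := h k hk
          rwa [Function.update_self] at this
        · trivial
    · rintro ⟨h1, h2⟩ i hi
      by_cases hk : i = k
      · subst hk
        rw [Function.update_self]
        rwa [if_pos hi] at h2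
      · rw [Function.update_of_ne hk]
        exact h1 i ⟨hi, hk⟩
  rw [e, Measure.prod_prod, Measure.infinitePi_pi _ (fun i _ => ht i)]
  have e2 : ∏ i ∈ s.erase k, Function.update fac k m i (t i) = ∏ i ∈ s.erase k, fac i (t i) :=
    Finset.prod_congr rfl fun i hi => by rw [Function.update_of_ne (Finset.ne_of_mem_erase hi)]
  split_ifs with hk
  · rw [← Finset.prod_erase_mul s _ hk, e2, Function.update_self]
  · rw [measure_univ, mul_one, ← e2, Finset.erase_eq_of_notMem hk]

lemma integral_update (fac : ℤ → Measure (ℕ × ℕ)) [∀ i, IsProbabilityMeasure (fac i)] (k : ℤ)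
    (m : Measure (ℕ × ℕ)) [IsProbabilityMeasure m]
    [∀ i, IsProbabilityMeasure (Function.update fac k m i)] (F : (ℤ → ℕ × ℕ) → ℝ) (hF : BM F) :
    ∫ u, F u ∂(Measure.infinitePi (Function.update fac k m))
      = ∫ u, ∫ y, F (Function.update u k y) ∂m ∂(Measure.infinitePi fac) := by
  rw [← map_update, integral_map (measurable_update2 k).aemeasurable hF.1.aestronglyMeasurable,
    integral_prod]
  obtain ⟨h1, C, hC⟩ := hF
  exact Integrable.of_bound (h1.comp (measurable_update2 k)).aestronglyMeasurable C
    (Filter.Eventually.of_forall fun p => hC _)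

/-- The single-site change of variables, lifted to the product measure. -/
lemma single_site (fac fac' : ℤ → Measure (ℕ × ℕ)) [∀ i, IsProbabilityMeasure (fac i)]
    [∀ i, IsProbabilityMeasure (fac' i)] (k : ℤ) (hfac : ∀ i, i ≠ k → fac' i = fac i)
    (w w' : ℕ × ℕ → ℝ) (hw : ∃ C, ∀ y, |w y| ≤ C) (hw' : ∃ C, ∀ y, |w' y| ≤ C)
    (t t' : ℕ × ℕ → ℕ × ℕ)
    (h : ∀ F : ℕ × ℕ → ℝ, (∃ C, ∀ y, |F y| ≤ C) →
      ∫ y, w y * F (t y) ∂(fac k) = ∫ y, w' y * F (t' y) ∂(fac' k))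
    (F : (ℤ → ℕ × ℕ) → ℝ) (hF : BM F) :
    ∫ u, w (u k) * F (upd k t u) ∂(Measure.infinitePi fac)
      = ∫ u, w' (u k) * F (upd k t' u) ∂(Measure.infinitePi fac') := by
  have e' : fac' = Function.update fac k (fac' k) := by
    funext i
    by_cases hi : i = k
    · subst hi; simp
    · rw [Function.update_of_ne hi, hfac i hi]
  have e : fac = Function.update fac k (fac k) := by simp
  have i1 : ∀ i, IsProbabilityMeasure (Function.update fac k (fac k) i) := by
    rw [← e]; infer_instance
  have i2 : ∀ i, IsProbabilityMeasure (Function.update fac k (fac' k) i) := by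
    rw [← e']; infer_instance
  have a1 := integral_update fac k (fac k) _ ((BM.site w hw k).mul (hF.upd k t))
  have a2 := integral_update fac k (fac' k) _ ((BM.site w' hw' k).mul (hF.upd k t'))
  simp only [← e] at a1
  simp only [← e'] at a2
  rw [a1, a2]
  congr 1
  funext u
  simp only [upd, Function.update_self, Function.update_idem]
  exact h (fun y => F (Function.update u k y)) (hF.2.imp fun _ h _ => h _)

/-! ### The shock measures -/

/-- local parameter -/
noncomputable def tilt (θ σ : ℝ) (j i : ℤ) : ℝ := if i < j then θ else σ

/-- site marginals of the shock measure -/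
noncomputable def facs (g : ℕ → ℝ) (θ σ : ℝ) (j i : ℤ) : Measure (ℕ × ℕ) :=
  mS g (tilt θ σ j i) (if i = j then 1 else 0)

lemma shockFactor_eq (g : ℕ → ℝ) (θ σ : ℝ) (j : ℤ) :
    shockFactor g θ σ (muN g σ) j = facs g θ σ j := by
  funext i
  unfold shockFactor facs tilt mS
  by_cases h1 : i < j
  · have h2 : i ≠ j := by omega
    simp [h1, h2]
  · by_cases h2 : i = j
    · simp [h2]
    · simp [h1, h2]

/-- both particles in -/
def incB (y : ℕ × ℕ) : ℕ × ℕ := (y.1 + 1, y.2 + 1)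
/-- both particles out -/
def decB (y : ℕ × ℕ) : ℕ × ℕ := (y.1 - 1, y.2 - 1)
/-- second class particle in -/
def incS (y : ℕ × ℕ) : ℕ × ℕ := (y.1, y.2 + 1)
/-- second class particle out -/
def decS (y : ℕ × ℕ) : ℕ × ℕ := (y.1, y.2 - 1)

@[simp] lemma upd_id (k : ℤ) (u : ℤ → ℕ × ℕ) : upd k id u = u := by
  simp [upd]

/-- the `i`-th term of the generator in the paired coordinates -/
noncomputable def termU (g : ℕ → ℝ) (Φ : (ℤ → ℕ × ℕ) → ℝ) (i : ℤ) (u : ℤ → ℕ × ℕ) : ℝ :=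
  (g (u i).1 * Φ (upd (i + 1) incB (upd i decB u)) - g (u i).1 * Φ u)
    + ((g (u i).2 - g (u i).1) * Φ (upd (i + 1) incS (upd i decS u))
      - (g (u i).2 - g (u i).1) * Φ u)

section Shock

variable {𝔞 β θ σ : ℝ} {g : ℕ → ℝ}

lemma tilt_lt (hβ : 0 < β) (hσ : θ + β = σ) (hσa : exp σ < 𝔞) (j i : ℤ) :
    exp (tilt θ σ j i) < 𝔞 := by
  unfold tilt
  split_ifs
  · exact lt_of_le_of_lt (Real.exp_le_exp.2 (by linarith)) hσa
  · exact hσa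

lemma facs_prob (h𝔞 : 0 < 𝔞) (hβ : 0 < β) (hg : ∀ y : ℕ, g y = 𝔞 * (1 - exp (-β * y)))
    (hσ : θ + β = σ) (hσa : exp σ < 𝔞) (j i : ℤ) : IsProbabilityMeasure (facs g θ σ j i) :=
  mS_prob h𝔞 hβ hg (tilt_lt hβ hσ hσa j i) _

lemma bd_g1 (h𝔞 : 0 < 𝔞) (hβ : 0 < β) (hg : ∀ y : ℕ, g y = 𝔞 * (1 - exp (-β * y))) :
    ∃ C, ∀ y : ℕ × ℕ, |g y.1| ≤ C := ⟨𝔞, fun y => g_abs_le h𝔞 hβ hg _⟩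

lemma bd_g2 (h𝔞 : 0 < 𝔞) (hβ : 0 < β) (hg : ∀ y : ℕ, g y = 𝔞 * (1 - exp (-β * y))) :
    ∃ C, ∀ y : ℕ × ℕ, |g y.2| ≤ C := ⟨𝔞, fun y => g_abs_le h𝔞 hβ hg _⟩

lemma bd_gd (h𝔞 : 0 < 𝔞) (hβ : 0 < β) (hg : ∀ y : ℕ, g y = 𝔞 * (1 - exp (-β * y))) :
    ∃ C, ∀ y : ℕ × ℕ, |g y.2 - g y.1| ≤ C :=
  ⟨𝔞 + 𝔞, fun _ => (abs_sub _ _).trans (add_le_add (g_abs_le h𝔞 hβ hg _) (g_abs_le h𝔞 hβ hg _))⟩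

lemma bd_const (c : ℝ) : ∃ C, ∀ y : ℕ × ℕ, |(fun _ => c : ℕ × ℕ → ℝ) y| ≤ C := ⟨|c|, fun _ => le_rfl⟩

lemma BM_termU (h𝔞 : 0 < 𝔞) (hβ : 0 < β) (hg : ∀ y : ℕ, g y = 𝔞 * (1 - exp (-β * y)))
    (Φ : (ℤ → ℕ × ℕ) → ℝ) (hΦ : BM Φ) (i : ℤ) : BM (termU g Φ i) := by
  have b1 := BM.site (fun y => g y.1) (bd_g1 h𝔞 hβ hg) i
  have bd := BM.site (fun y => g y.2 - g y.1) (bd_gd h𝔞 hβ hg) i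
  exact ((b1.mul ((hΦ.upd (i + 1) incB).upd i decB)).sub (b1.mul hΦ)).add
    ((bd.mul ((hΦ.upd (i + 1) incS).upd i decS)).sub (bd.mul hΦ))

/-- weighted expectation -/
noncomputable def AA (g : ℕ → ℝ) (θ σ : ℝ) (j : ℤ)
    (hp : ∀ i, IsProbabilityMeasure (facs g θ σ j i)) (Φ : (ℤ → ℕ × ℕ) → ℝ) (i : ℤ) : ℝ :=
  ∫ u, g (u i).1 * Φ u ∂(Measure.infinitePi (facs g θ σ j))

lemma int_move (h𝔞 : 0 < 𝔞) (hβ : 0 < β) (hg : ∀ y : ℕ, g y = 𝔞 * (1 - exp (-β * y)))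
    (hσ : θ + β = σ) (hσa : exp σ < 𝔞) (j : ℤ)
    (hp : ∀ i, IsProbabilityMeasure (facs g θ σ j i)) (Φ : (ℤ → ℕ × ℕ) → ℝ) (hΦ : BM Φ) (i : ℤ) :
    ∫ u, g (u i).1 * Φ (upd (i + 1) incB (upd i decB u)) ∂(Measure.infinitePi (facs g θ σ j))
      = exp (tilt θ σ j i - tilt θ σ j (i + 1)) * AA g θ σ j hp Φ (i + 1) := by
  have h1 := single_site (facs g θ σ j) (facs g θ σ j) i (fun _ _ => rfl) (fun y => g y.1)
    (fun _ => exp (tilt θ σ j i)) (bd_g1 h𝔞 hβ hg) (bd_const _) decB id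
    (fun F hF => mS_dec h𝔞 hβ hg (tilt_lt hβ hσ hσa j i) _ F hF)
    (fun u => Φ (upd (i + 1) incB u)) (hΦ.upd _ _)
  have h2 := single_site (facs g θ σ j) (facs g θ σ j) (i + 1) (fun _ _ => rfl)
    (fun _ => exp (tilt θ σ j (i + 1))) (fun y => g y.1) (bd_const _) (bd_g1 h𝔞 hβ hg) incB id
    (fun F hF => mS_inc h𝔞 hβ hg (tilt_lt hβ hσ hσa j (i + 1)) _ F hF) Φ hΦ
  simp only [upd_id, integral_const_mul] at h1 h2
  rw [h1, AA, ← h2, ← mul_assoc, ← Real.exp_add, sub_add_cancel]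

lemma int_jump (h𝔞 : 0 < 𝔞) (hβ : 0 < β) (hg : ∀ y : ℕ, g y = 𝔞 * (1 - exp (-β * y)))
    (hσ : θ + β = σ) (hσa : exp σ < 𝔞) (j : ℤ)
    (hp : ∀ j i, IsProbabilityMeasure (facs g θ σ j i)) (Φ : (ℤ → ℕ × ℕ) → ℝ) (hΦ : BM Φ) :
    ∫ u, (g (u j).2 - g (u j).1) * Φ (upd (j + 1) incS (upd j decS u))
        ∂(Measure.infinitePi (facs g θ σ j))
      = (1 - exp (-β)) * (𝔞 - exp σ) * ∫ u, Φ u ∂(Measure.infinitePi (facs g θ σ (j + 1))) := by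
  have hp' : ∀ i, IsProbabilityMeasure (mS g (tilt θ σ (j + 1) i) 0) := fun i =>
    mS_prob h𝔞 hβ hg (tilt_lt hβ hσ hσa _ i) _
  have h1 := single_site (facs g θ σ j) (fun i => mS g (tilt θ σ (j + 1) i) 0) j
    (fun i hi => by
      simp only [facs, if_neg hi, tilt]
      congr 1
      exact if_congr (by omega) rfl rfl)
    (fun y => g y.2 - g y.1) (fun _ => (1 - exp (-β)) * (𝔞 - exp σ))
    (bd_gd h𝔞 hβ hg) (bd_const _) decS id
    (fun F hF => by
      simp only [facs, tilt, if_true, lt_irrefl, if_false, lt_add_one]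
      exact mS_jump h𝔞 hβ hg hσ hσa F hF)
    (fun u => Φ (upd (j + 1) incS u)) (hΦ.upd _ _)
  have h2 := single_site (fun i => mS g (tilt θ σ (j + 1) i) 0) (facs g θ σ (j + 1)) (j + 1)
    (fun i hi => by simp only [facs, if_neg hi])
    (fun _ => 1) (fun _ => 1) (bd_const _) (bd_const _) incS id
    (fun F hF => by
      simp only [facs, tilt, if_true, lt_irrefl, if_false, one_mul]
      exact mS_raise h𝔞 hβ hg hσa F hF) Φ hΦ
  simp only [upd_id, integral_const_mul, one_mul] at h1 h2
  rw [h1, h2]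

lemma int_diag (h𝔞 : 0 < 𝔞) (hβ : 0 < β) (hg : ∀ y : ℕ, g y = 𝔞 * (1 - exp (-β * y)))
    (hσ : θ + β = σ) (hσa : exp σ < 𝔞) (j : ℤ)
    (hp : ∀ i, IsProbabilityMeasure (facs g θ σ j i)) (Φ : (ℤ → ℕ × ℕ) → ℝ) (hΦ : BM Φ) (i : ℤ)
    (hi : i ≠ j) :
    ∫ u, (g (u i).2 - g (u i).1) * Φ u ∂(Measure.infinitePi (facs g θ σ j)) = 0 := by
  have h1 := single_site (facs g θ σ j) (facs g θ σ j) i (fun _ _ => rfl)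
    (fun y => g y.2 - g y.1)
    (fun _ => 0) (bd_gd h𝔞 hβ hg) (bd_const _) id id
    (fun F hF => by
      simp only [facs, if_neg hi, zero_mul, integral_zero]
      exact mS_diag h𝔞 hβ hg (tilt_lt hβ hσ hσa j i) F hF) Φ hΦ
  simpa using h1

lemma int_second (h𝔞 : 0 < 𝔞) (hβ : 0 < β) (hg : ∀ y : ℕ, g y = 𝔞 * (1 - exp (-β * y)))
    (hσ : θ + β = σ) (hσa : exp σ < 𝔞) (j : ℤ)
    (hp : ∀ i, IsProbabilityMeasure (facs g θ σ j i)) (Φ : (ℤ → ℕ × ℕ) → ℝ) (hΦ : BM Φ) :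
    ∫ u, g (u j).2 * Φ u ∂(Measure.infinitePi (facs g θ σ j))
      = exp (-β) * AA g θ σ j hp Φ j
        + 𝔞 * (1 - exp (-β)) * ∫ u, Φ u ∂(Measure.infinitePi (facs g θ σ j)) := by
  have hb : ∃ C, ∀ y : ℕ × ℕ, |exp (-β) * g y.1 + 𝔞 * (1 - exp (-β))| ≤ C := by
    refine ⟨exp (-β) * 𝔞 + |𝔞 * (1 - exp (-β))|, fun y => ?_⟩
    refine (abs_add_le _ _).trans (add_le_add ?_ le_rfl)
    rw [abs_mul, abs_of_pos (exp_pos _)]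
    exact mul_le_mul_of_nonneg_left (g_abs_le h𝔞 hβ hg _) (exp_pos _).le
  have h1 := single_site (facs g θ σ j) (facs g θ σ j) j (fun _ _ => rfl)
    (fun y => g y.2) (fun y => exp (-β) * g y.1 + 𝔞 * (1 - exp (-β)))
    (bd_g2 h𝔞 hβ hg) hb id id
    (fun F hF => by
      simp only [facs, if_true]
      exact mS_second h𝔞 hβ hg (tilt_lt hβ hσ hσa j j) F hF) Φ hΦ
  simp only [upd_id] at h1
  rw [h1, AA, ← integral_const_mul, ← integral_const_mul, ← integral_add]
  · congr 1; funext u; ring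
  · exact (((BM.site (fun y => g y.1) (bd_g1 h𝔞 hβ hg) j).mul hΦ).integrable _).const_mul _
  · exact (hΦ.integrable _).const_mul _

lemma AA_outside (h𝔞 : 0 < 𝔞) (hβ : 0 < β) (hg : ∀ y : ℕ, g y = 𝔞 * (1 - exp (-β * y)))
    (hσ : θ + β = σ) (hσa : exp σ < 𝔞) (j : ℤ)
    (hp : ∀ i, IsProbabilityMeasure (facs g θ σ j i)) (Φ : (ℤ → ℕ × ℕ) → ℝ) (hΦ : BM Φ) (i : ℤ)
    (hout : ∀ t u, Φ (upd i t u) = Φ u) :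
    AA g θ σ j hp Φ i
      = exp (tilt θ σ j i) * ∫ u, Φ u ∂(Measure.infinitePi (facs g θ σ j)) := by
  have h1 := single_site (facs g θ σ j) (facs g θ σ j) i (fun _ _ => rfl) (fun y => g y.1)
    (fun _ => exp (tilt θ σ j i)) (bd_g1 h𝔞 hβ hg) (bd_const _) decB id
    (fun F hF => mS_dec h𝔞 hβ hg (tilt_lt hβ hσ hσa j i) _ F hF)
    Φ hΦ
  simp only [hout, integral_const_mul] at h1
  exact h1

lemma int_term (h𝔞 : 0 < 𝔞) (hβ : 0 < β) (hg : ∀ y : ℕ, g y = 𝔞 * (1 - exp (-β * y)))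
    (hσ : θ + β = σ) (hσa : exp σ < 𝔞) (j : ℤ)
    (hp : ∀ j i, IsProbabilityMeasure (facs g θ σ j i)) (Φ : (ℤ → ℕ × ℕ) → ℝ) (hΦ : BM Φ) (i : ℤ) :
    ∫ u, termU g Φ i u ∂(Measure.infinitePi (facs g θ σ j))
      = (AA g θ σ j (hp j) Φ (i + 1) - AA g θ σ j (hp j) Φ i)
        + (if i = j - 1 then (exp (-β) - 1) * AA g θ σ j (hp j) Φ j else 0)
        + (if i = j then (1 - exp (-β)) * AA g θ σ j (hp j) Φ j
            - 𝔞 * (1 - exp (-β)) * (∫ u, Φ u ∂(Measure.infinitePi (facs g θ σ j)))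
            + (1 - exp (-β)) * (𝔞 - exp σ)
              * ∫ u, Φ u ∂(Measure.infinitePi (facs g θ σ (j + 1))) else 0) := by
  have b1 := BM.site (fun y => g y.1) (bd_g1 h𝔞 hβ hg) i
  have b2 := BM.site (fun y => g y.2) (bd_g2 h𝔞 hβ hg) i
  have bd := BM.site (fun y => g y.2 - g y.1) (bd_gd h𝔞 hβ hg) i
  have t1 := b1.mul ((hΦ.upd (i + 1) incB).upd i decB)
  have t2 := b1.mul hΦ
  have t3 := bd.mul ((hΦ.upd (i + 1) incS).upd i decS)
  have t4 := bd.mul hΦ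
  unfold termU
  rw [integral_add ((t1.sub t2).integrable _) ((t3.sub t4).integrable _),
    integral_sub (t1.integrable _) (t2.integrable _),
    integral_sub (t3.integrable _) (t4.integrable _),
    int_move h𝔞 hβ hg hσ hσa j (hp j) Φ hΦ i]
  change _ - AA g θ σ j (hp j) Φ i + _ = _
  by_cases h1 : i = j
  · subst h1
    have e : ∫ u, (g (u i).2 - g (u i).1) * Φ u ∂(Measure.infinitePi (facs g θ σ i))
        = (∫ u, g (u i).2 * Φ u ∂(Measure.infinitePi (facs g θ σ i)))
          - AA g θ σ i (hp i) Φ i := by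
      rw [AA, ← integral_sub ((b2.mul hΦ).integrable _) (t2.integrable _)]
      congr 1; funext u; ring
    rw [e, int_jump h𝔞 hβ hg hσ hσa i hp Φ hΦ, int_second h𝔞 hβ hg hσ hσa i (hp i) Φ hΦ]
    have h2 : ¬ (i = i - 1) := by omega
    have h3 : ¬ (i + 1 < i) := by omega
    simp only [tilt, lt_irrefl, h2, h3, if_false, if_true, sub_self, exp_zero]
    ring
  · rw [int_diag h𝔞 hβ hg hσ hσa j (hp j) _ hΦ i h1]
    have h5 := int_diag h𝔞 hβ hg hσ hσa j (hp j) _ ((hΦ.upd (i + 1) incS).upd i decS) i h1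
    rw [h5]
    by_cases h2 : i = j - 1
    · subst h2
      have h3 : j - 1 < j := by omega
      have h4 : ¬ (j - 1 + 1 < j) := by omega
      have h6 : θ - σ = -β := by linarith
      simp only [tilt, h1, h3, h4, if_true, if_false, h6, sub_add_cancel, lt_irrefl]
      ring
    · have h3 : tilt θ σ j i = tilt θ σ j (i + 1) := if_congr (by omega) rfl rfl
      simp only [h3, h1, h2, if_false, sub_self, exp_zero]
      ring

lemma telescope (A : ℤ → ℝ) (l : ℤ) (N : ℕ) :
    ∑ i ∈ Finset.Ico l (l + N), (A (i + 1) - A i) = A (l + N) - A l := by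
  induction N with
  | zero => simp
  | succ n ih =>
    have e : Finset.Ico l (l + ((n + 1 : ℕ) : ℤ)) = insert (l + (n : ℤ)) (Finset.Ico l (l + n)) := by
      ext k; simp only [Finset.mem_Ico, Finset.mem_insert]; push_cast; omega
    rw [e, Finset.sum_insert (by simp), ih]
    push_cast
    rw [show l + ((n : ℤ) + 1) = l + n + 1 by ring]
    ring

lemma int_sum (h𝔞 : 0 < 𝔞) (hβ : 0 < β) (hg : ∀ y : ℕ, g y = 𝔞 * (1 - exp (-β * y)))
    (hσ : θ + β = σ) (hσa : exp σ < 𝔞) (j : ℤ)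
    (hp : ∀ j i, IsProbabilityMeasure (facs g θ σ j i)) (Φ : (ℤ → ℕ × ℕ) → ℝ) (hΦ : BM Φ)
    (l r : ℤ) (hl : l < j) (hr : j < r)
    (hol : ∀ t u, Φ (upd l t u) = Φ u) (hor : ∀ t u, Φ (upd r t u) = Φ u) :
    ∫ u, ∑ i ∈ Finset.Ico l r, termU g Φ i u ∂(Measure.infinitePi (facs g θ σ j))
      = (1 - exp (-β)) * (𝔞 - exp σ) * ((∫ u, Φ u ∂(Measure.infinitePi (facs g θ σ (j + 1))))
        - ∫ u, Φ u ∂(Measure.infinitePi (facs g θ σ j))) := by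
  rw [integral_finsetSum _ fun i _ => (BM_termU h𝔞 hβ hg Φ hΦ i).integrable _]
  simp only [int_term h𝔞 hβ hg hσ hσa j hp Φ hΦ]
  rw [Finset.sum_add_distrib, Finset.sum_add_distrib, Finset.sum_ite_eq', Finset.sum_ite_eq']
  obtain ⟨N, hN⟩ : ∃ N : ℕ, r = l + N := ⟨(r - l).toNat, by omega⟩
  have tel := telescope (AA g θ σ j (hp j) Φ) l N
  rw [← hN] at tel
  rw [tel, if_pos (by simp; omega), if_pos (by simp; omega),
    AA_outside h𝔞 hβ hg hσ hσa j (hp j) Φ hΦ l hol,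
    AA_outside h𝔞 hβ hg hσ hσa j (hp j) Φ hΦ r hor]
  have e1 : tilt θ σ j l = θ := if_pos hl
  have e2 : tilt θ σ j r = σ := if_neg (by omega)
  have e3 : exp θ = exp σ * exp (-β) := by
    rw [← Real.exp_add]; congr 1; linarith
  rw [e1, e2, e3]
  ring

end Shock

/-- pairing the coordinates -/
def pairU (x : ConfN × ConfN) : ℤ → ℕ × ℕ := fun i => (x.1 i, x.2 i)

/-- unpairing the coordinates -/
def unpairU (u : ℤ → ℕ × ℕ) : ConfN × ConfN := (fun i => (u i).1, fun i => (u i).2)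

lemma unpair_pair (x : ConfN × ConfN) : unpairU (pairU x) = x := rfl

lemma measurable_pairU : Measurable pairU := by
  refine measurable_pi_iff.2 fun i => ?_
  exact ((measurable_pi_apply i).comp measurable_fst).prodMk
    ((measurable_pi_apply i).comp measurable_snd)

lemma map_pairU (fac : ℤ → Measure (ℕ × ℕ)) [∀ i, IsProbabilityMeasure (fac i)]
    (ν : Measure (ConfN × ConfN)) (h : IsProductMeasure fac ν) :
    ν.map pairU = Measure.infinitePi fac := by
  refine Measure.eq_infinitePi _ fun s t ht => ?_
  rw [Measure.map_apply measurable_pairU (MeasurableSet.pi s.countable_toSet fun i _ => ht i), ← h s t]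
  rfl

lemma cyl_BM (φ : ConfN × ConfN → ℝ) (hφ : IsBddCylinder φ) : BM fun u => φ (unpairU u) := by
  obtain ⟨⟨s, hs⟩, C, hC⟩ := hφ
  refine ⟨?_, C, fun u => hC _⟩
  have e : (fun u => φ (unpairU u)) = (fun v : s → ℕ × ℕ =>
      φ (unpairU fun i => if h : i ∈ s then v ⟨i, h⟩ else 0)) ∘ (fun u (i : s) => u i) := by
    funext u
    refine hs _ _ fun i hi => ?_
    simp [unpairU, hi]
  rw [e]
  refine (measurable_of_countable _).comp ?_
  exact measurable_pi_iff.2 fun i => measurable_pi_apply _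

lemma unpair_incB (x : ConfN × ConfN) (i : ℤ) :
    unpairU (upd (i + 1) incB (upd i decB (pairU x)))
      = (moveN x.1 i (i + 1), moveN x.2 i (i + 1)) := by
  have h0 : i + 1 ≠ i := by omega
  apply Prod.ext <;> funext k <;> by_cases h1 : k = i <;> by_cases h2 : k = i + 1 <;>
    first
      | omega
      | (subst h1; simp [unpairU, upd, moveN, pairU, incB, decB, Function.update])
      | (subst h2; simp [unpairU, upd, moveN, pairU, incB, decB, Function.update])
      | simp [unpairU, upd, moveN, pairU, Function.update, h1, h2]

lemma unpair_incS (x : ConfN × ConfN) (i : ℤ) :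
    unpairU (upd (i + 1) incS (upd i decS (pairU x))) = (x.1, moveN x.2 i (i + 1)) := by
  have h0 : i + 1 ≠ i := by omega
  apply Prod.ext <;> funext k <;> by_cases h1 : k = i <;> by_cases h2 : k = i + 1 <;>
    first
      | omega
      | (subst h1; simp [unpairU, upd, moveN, pairU, incS, decS, Function.update])
      | (subst h2; simp [unpairU, upd, moveN, pairU, incS, decS, Function.update])
      | simp [unpairU, upd, moveN, pairU, Function.update, h1, h2]

lemma LN_eq (g : ℕ → ℝ) (φ : ConfN × ConfN → ℝ) (x : ConfN × ConfN) :
    LN 1 g φ x = ∑' i : ℤ, termU g (fun u => φ (unpairU u)) i (pairU x) := by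
  unfold LN termU
  congr 1; funext i
  simp only [unpair_incB, unpair_incS, unpair_pair]
  simp only [pairU]
  ring

lemma cyl_upd (φ : ConfN × ConfN → ℝ) (s : Finset ℤ)
    (hs : ∀ x y : ConfN × ConfN, (∀ i ∈ s, x.1 i = y.1 i ∧ x.2 i = y.2 i) → φ x = φ y)
    (k : ℤ) (hk : k ∉ s) (t : ℕ × ℕ → ℕ × ℕ) (u : ℤ → ℕ × ℕ) :
    φ (unpairU (upd k t u)) = φ (unpairU u) := by
  refine hs _ _ fun i hi => ?_
  have : i ≠ k := fun h => hk (h ▸ hi)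
  simp [unpairU, upd, Function.update_of_ne this]


/-- Case (ii) of Theorem 1: the totally asymmetric q-zero range process. For
`g(y) = 𝔞·(1 - e^{-βy})`, `p = 1`, `θ + β = σ < ln 𝔞` and `μ̂ = μ^σ`, the single-shock
measure satisfies the random walking shock property with rates
`P = (1 - e^{-β})·(𝔞 - e^σ)` and `Q = 0`. -/
theorem rws_qTAZRP
    (𝔞 β θ σ : ℝ) (h𝔞 : 0 < 𝔞) (hβ : 0 < β)
    (hσ : θ + β = σ) (hσa : exp σ < 𝔞)
    (g : ℕ → ℝ) (hg : ∀ y : ℕ, g y = 𝔞 * (1 - exp (-β * y)))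
    (ν : ℤ → Measure (ConfN × ConfN))
    (hν : ∀ j : ℤ, IsProductMeasure (shockFactor g θ σ (muN g σ) j) (ν j))
    (j : ℤ) (φ : ConfN × ConfN → ℝ) (hφ : IsBddCylinder φ) :
    ∫ x, LN 1 g φ x ∂(ν j)
      = (1 - exp (-β)) * (𝔞 - exp σ) * ((∫ x, φ x ∂(ν (j + 1))) - ∫ x, φ x ∂(ν j)) := by
  have hp : ∀ j i, IsProbabilityMeasure (facs g θ σ j i) := facs_prob h𝔞 hβ hg hσ hσa
  have hmap : ∀ j, (ν j).map pairU = Measure.infinitePi (facs g θ σ j) := fun j =>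
    map_pairU _ _ (by rw [← shockFactor_eq]; exact hν j)
  have hΦ := cyl_BM φ hφ
  obtain ⟨⟨s, hs⟩, -⟩ := hφ
  obtain ⟨r, hr⟩ := (insert j s).bddAbove
  obtain ⟨l, hl⟩ := (insert j s).bddBelow
  have hr' : ∀ i ∈ insert j s, i < r + 1 := fun i hi => Int.lt_add_one_of_le (hr hi)
  have hl' : ∀ i ∈ insert j s, l - 1 < i := fun i hi => Int.sub_one_lt_of_le (hl hi)
  have houtr : ∀ k, r + 1 ≤ k → k ∉ s := fun k hk hks => by
    have := hr' k (Finset.mem_insert_of_mem hks)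
    omega
  have houtl : ∀ k, k ≤ l - 1 → k ∉ s := fun k hk hks => by
    have := hl' k (Finset.mem_insert_of_mem hks)
    omega
  have hlj := hl' j (Finset.mem_insert_self _ _)
  have hrj := hr' j (Finset.mem_insert_self _ _)
  have hupd := cyl_upd φ s hs
  have hLN : ∀ x, LN 1 g φ x = ∑ i ∈ Finset.Ico (l - 1) (r + 1),
      termU g (fun u => φ (unpairU u)) i (pairU x) := by
    intro x
    rw [LN_eq]
    refine tsum_eq_sum fun i hi => ?_
    have h1 : i ∉ s ∧ i + 1 ∉ s := by
      rw [Finset.mem_Ico] at hi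
      by_cases h : i < l - 1
      · exact ⟨houtl _ (by omega), houtl _ (by omega)⟩
      · exact ⟨houtr _ (by omega), houtr _ (by omega)⟩
    unfold termU
    simp only [hupd _ h1.1, hupd _ h1.2]
    ring
  have hint : ∀ (F : (ℤ → ℕ × ℕ) → ℝ), Measurable F → ∀ j,
      ∫ x, F (pairU x) ∂(ν j) = ∫ u, F u ∂(Measure.infinitePi (facs g θ σ j)) := by
    intro F hF j
    rw [← hmap, integral_map measurable_pairU.aemeasurable hF.aestronglyMeasurable]
  have i1 := fun j => hint _ hΦ.1 j
  simp only [unpair_pair] at i1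
  have i2 := hint (fun u => ∑ i ∈ Finset.Ico (l - 1) (r + 1),
      termU g (fun u => φ (unpairU u)) i u)
    (Finset.measurable_fun_sum _ fun i _ => (BM_termU h𝔞 hβ hg _ hΦ i).1) j
  simp only [hLN]
  rw [i2, i1, i1]
  exact int_sum h𝔞 hβ hg hσ hσa j hp _ hΦ (l - 1) (r + 1) hlj hrj
    (hupd _ (houtl _ le_rfl)) (hupd _ (houtr _ le_rfl))
end

section
/- Let g: ℕ → [0,∞) be nondecreasing and not constant on {1,2,...}, with g(0) = 0 and g(z) > 0 for z ≥ 1, let 0 < p < 1, let θ, σ be real numbers with Z(θ), Z(σ) < ∞, let μ̂ be a probability distribution on ℕ, and suppose the single-shock measure ν_j satisfies the random walking shock property with some rates P, Q ≥ 0. Then necessarily θ = σ, μ̂ = μ^θ = μ^σ, and g is linear: g(y) = 𝔞·y for all y ∈ ℕ with 𝔞 = g(1) > 0; moreover P = p·𝔞 and Q = (1−p)·𝔞. -/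
open MeasureTheory Real

theorem aux_site_singleton (f : ℕ × ℕ → ℝ) (u : ℕ × ℕ) (h : 0 ≤ f u) :
    (siteMeasure f {u}).toReal = f u := by
  unfold siteMeasure
  rw [withDensity_apply _ (measurableSet_singleton u)]
  simp [h]

theorem aux_site_zero (f : ℕ × ℕ → ℝ) (B : Set (ℕ × ℕ)) (h : ∀ u ∈ B, f u = 0) :
    siteMeasure f B = 0 := by
  unfold siteMeasure
  rw [withDensity_apply _ B.to_countable.measurableSet, lintegral_eq_zero_iff (by fun_prop)]
  rw [Filter.EventuallyEq, ae_restrict_iff' B.to_countable.measurableSet]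
  filter_upwards with u hu
  simp [h u hu]

theorem aux_gfact_pos (g : ℕ → ℝ) (hgpos : ∀ z : ℕ, 1 ≤ z → 0 < g z) (z : ℕ) :
    0 < gfact g z := by
  unfold gfact
  exact Finset.prod_pos fun y hy => hgpos y (Finset.mem_Icc.mp hy).1

theorem aux_ZN_pos (g : ℕ → ℝ) (hgpos : ∀ z : ℕ, 1 ≤ z → 0 < g z) (θ : ℝ)
    (hZ : Summable fun z : ℕ => exp (θ * z) / gfact g z) : 0 < ZN g θ := by
  unfold ZN
  exact hZ.tsum_pos (fun z => (div_pos (exp_pos _) (aux_gfact_pos g hgpos z)).le) 0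
    (div_pos (exp_pos _) (aux_gfact_pos g hgpos 0))

theorem aux_muN_pos (g : ℕ → ℝ) (hgpos : ∀ z : ℕ, 1 ≤ z → 0 < g z) (θ : ℝ)
    (hZ : Summable fun z : ℕ => exp (θ * z) / gfact g z) (z : ℕ) : 0 < muN g θ z :=
  div_pos (exp_pos _) (mul_pos (aux_gfact_pos g hgpos z) (aux_ZN_pos g hgpos θ hZ))

theorem aux_muN_tsum (g : ℕ → ℝ) (hgpos : ∀ z : ℕ, 1 ≤ z → 0 < g z) (θ : ℝ)
    (hZ : Summable fun z : ℕ => exp (θ * z) / gfact g z) : ∑' z, muN g θ z = 1 := by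
  have h : ∀ z, muN g θ z = (exp (θ * z) / gfact g z) / ZN g θ := by
    intro z; unfold muN; rw [div_div]
  simp_rw [h]
  rw [tsum_div_const]
  exact div_self (aux_ZN_pos g hgpos θ hZ).ne'

theorem aux_muN_inj (g : ℕ → ℝ) (hgpos : ∀ z : ℕ, 1 ≤ z → 0 < g z) (θ σ : ℝ)
    (hZ : Summable fun z : ℕ => exp (θ * z) / gfact g z)
    (h : ∀ z, muN g θ z = muN g σ z) : θ = σ := by
  have hp := aux_ZN_pos g hgpos θ hZ
  have h0 := h 0
  have h1 := h 1
  have hg1 := hgpos 1 le_rfl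
  simp [muN, gfact] at h0 h1
  rw [← h0] at h1
  have h2 := (div_left_inj' (mul_pos hg1 hp).ne').mp h1
  exact exp_injective h2

/-- The two-site cylinder event. -/
def auxCyl (a e : ℤ) (u w : ℕ × ℕ) : Set (ConfN × ConfN) :=
  {x | (x.1 a, x.2 a) = u ∧ (x.1 e, x.2 e) = w}

theorem aux_cyl_meas (a e : ℤ) (u w : ℕ × ℕ) : MeasurableSet (auxCyl a e u w) := by
  have h : ∀ i : ℤ, Measurable fun x : ConfN × ConfN => (x.1 i, x.2 i) := by
    intro i; fun_prop
  exact (h a (measurableSet_singleton u)).inter (h e (measurableSet_singleton w))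

theorem aux_cyl_bdd (a e : ℤ) (u w : ℕ × ℕ) :
    IsBddCylinder ((auxCyl a e u w).indicator fun _ => (1 : ℝ)) := by
  classical
  refine ⟨⟨{a, e}, ?_⟩, 1, ?_⟩
  · intro x y h
    have ha := h a (by simp)
    have he := h e (by simp)
    have hm : x ∈ auxCyl a e u w ↔ y ∈ auxCyl a e u w := by
      simp [auxCyl, ha, he]
    by_cases hy : y ∈ auxCyl a e u w
    · rw [Set.indicator_of_mem hy, Set.indicator_of_mem (hm.mpr hy)]
    · rw [Set.indicator_of_notMem hy, Set.indicator_of_notMem (fun h => hy (hm.mp h))]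
  · intro x
    by_cases h : x ∈ auxCyl a e u w <;> simp [h]

theorem aux_cyl_prob (fac : ℤ → Measure (ℕ × ℕ)) (ν : Measure (ConfN × ConfN))
    (h : IsProductMeasure fac ν) (a e : ℤ) (hae : a ≠ e) (u w : ℕ × ℕ) :
    ∫ x, (auxCyl a e u w).indicator (fun _ => (1 : ℝ)) x ∂ν
      = (fac a {u}).toReal * (fac e {w}).toReal := by
  rw [integral_indicator (aux_cyl_meas a e u w)]
  have h1 := h {a, e} (fun i => if i = a then {u} else {w})
  rw [Finset.prod_pair hae] at h1
  have h2 : {x : ConfN × ConfN | ∀ i ∈ ({a, e} : Finset ℤ),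
      (x.1 i, x.2 i) ∈ (if i = a then ({u} : Set (ℕ × ℕ)) else {w})} = auxCyl a e u w := by
    ext x
    simp [auxCyl, hae.symm]
  rw [h2] at h1
  simp [Measure.real, h1, hae.symm]

theorem aux_cyl_prob1 (fac : ℤ → Measure (ℕ × ℕ)) (ν : Measure (ConfN × ConfN))
    (h : IsProductMeasure fac ν) (a : ℤ) (u : ℕ × ℕ) :
    ν (auxCyl a a u u) = fac a {u} := by
  have h1 := h {a} (fun _ => {u})
  simp only [Finset.prod_singleton] at h1
  rw [← h1]
  congr 1
  ext x
  simp [auxCyl]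

theorem aux_shock_ae (g : ℕ → ℝ) (θ σ : ℝ) (μhat : ℕ → ℝ) (j : ℤ)
    (ν : Measure (ConfN × ConfN)) (h : IsProductMeasure (shockFactor g θ σ μhat j) ν) :
    ∀ᵐ x ∂ν, ∀ i, x.2 i = x.1 i + if i = j then 1 else 0 := by
  rw [ae_all_iff]
  intro i
  have h1 := h {i} (fun _ => {u | ¬ u.2 = u.1 + if i = j then 1 else 0})
  simp only [Finset.prod_singleton] at h1
  rw [ae_iff]
  have h2 : shockFactor g θ σ μhat j i {u | ¬ u.2 = u.1 + if i = j then 1 else 0} = 0 := by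
    unfold shockFactor
    rcases lt_trichotomy i j with hi | hi | hi
    · rw [if_pos hi]
      refine aux_site_zero _ _ fun u hu => if_neg ?_
      simpa [hi.ne] using hu
    · rw [if_neg (by omega), if_pos hi]
      refine aux_site_zero _ _ fun u hu => if_neg ?_
      simpa [hi] using hu
    · rw [if_neg (by omega), if_neg (by omega)]
      refine aux_site_zero _ _ fun u hu => if_neg ?_
      simpa [hi.ne'] using hu
  rw [h2] at h1
  rw [← h1]
  congr 1
  ext x
  simp

/-- Facts on moves of a coupled pair with discrepancy at `j`. -/
theorem aux_joint (g : ℕ → ℝ) (hg0 : g 0 = 0) (j : ℤ) (x : ConfN × ConfN)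
    (hx : ∀ i, x.2 i = x.1 i + if i = j then 1 else 0) (e : ℤ) (b c : ℕ) (i k : ℤ) :
    g (x.1 i) * (auxCyl j e (b, b) (c, c + 1)).indicator (fun _ => (1 : ℝ))
      (moveN x.1 i k, moveN x.2 i k) = 0 := by
  by_cases h0 : x.1 i = 0
  · simp [h0, hg0]
  · rw [Set.indicator_of_notMem, mul_zero]
    rintro ⟨h1, -⟩
    have := hx j
    have := hx i
    simp only [moveN, Prod.mk.injEq] at h1
    grind

theorem aux_rate (g : ℕ → ℝ) (j : ℤ) (x : ConfN × ConfN)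
    (hx : ∀ i, x.2 i = x.1 i + if i = j then 1 else 0) (i : ℤ) (hi : i ≠ j) :
    g (x.2 i) - g (x.1 i) = 0 := by
  simp [hx i, hi]

theorem aux_second (j : ℤ) (x : ConfN × ConfN)
    (hx : ∀ i, x.2 i = x.1 i + if i = j then 1 else 0) (e : ℤ) (he : e ≠ j) (b c : ℕ) :
    (auxCyl j e (b, b) (c, c + 1)).indicator (fun _ => (1 : ℝ)) (x.1, moveN x.2 j e)
      = (auxCyl j e (b, b + 1) (c, c)).indicator (fun _ => (1 : ℝ)) x := by
  have h1 := hx j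
  have h2 := hx e
  unfold Set.indicator
  congr 1
  simp only [auxCyl, moveN, Set.mem_ofPred_eq, Prod.mk.injEq, eq_iff_iff]
  simp [he] at h1 h2 ⊢
  omega

theorem aux_second' (j : ℤ) (x : ConfN × ConfN)
    (hx : ∀ i, x.2 i = x.1 i + if i = j then 1 else 0) (e : ℤ) (he : e ≠ j) (b c : ℕ)
    (k : ℤ) (hk : k ≠ e) :
    (auxCyl j e (b, b) (c, c + 1)).indicator (fun _ => (1 : ℝ)) (x.1, moveN x.2 j k) = 0 := by
  have h2 := hx e
  rw [Set.indicator_of_notMem]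
  rintro ⟨-, h1⟩
  simp only [moveN, Prod.mk.injEq] at h1
  grind

theorem aux_zero (j : ℤ) (x : ConfN × ConfN)
    (hx : ∀ i, x.2 i = x.1 i + if i = j then 1 else 0) (e : ℤ) (b c : ℕ) :
    (auxCyl j e (b, b) (c, c + 1)).indicator (fun _ => (1 : ℝ)) x = 0 := by
  have h2 := hx j
  rw [Set.indicator_of_notMem]
  rintro ⟨h1, -⟩
  simp only [Prod.mk.injEq] at h1
  grind

theorem aux_rate_cyl (g : ℕ → ℝ) (j : ℤ) (x : ConfN × ConfN) (e : ℤ) (b c : ℕ) :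
    (g (x.2 j) - g (x.1 j)) * (auxCyl j e (b, b + 1) (c, c)).indicator (fun _ => (1 : ℝ)) x
      = (g (b + 1) - g b) * (auxCyl j e (b, b + 1) (c, c)).indicator (fun _ => (1 : ℝ)) x := by
  by_cases h : x ∈ auxCyl j e (b, b + 1) (c, c)
  · have h1 := h.1
    simp only [Prod.mk.injEq] at h1
    rw [h1.1, h1.2]
  · simp [h]

theorem aux_LN_right (p : ℝ) (g : ℕ → ℝ) (hg0 : g 0 = 0) (j : ℤ) (x : ConfN × ConfN)
    (hx : ∀ i, x.2 i = x.1 i + if i = j then 1 else 0) (b c : ℕ) :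
    LN p g ((auxCyl j (j + 1) (b, b) (c, c + 1)).indicator fun _ => (1 : ℝ)) x
      = p * (g (b + 1) - g b) *
        (auxCyl j (j + 1) (b, b + 1) (c, c)).indicator (fun _ => (1 : ℝ)) x := by
  unfold LN
  rw [tsum_eq_single j]
  · rw [aux_zero j x hx, aux_second j x hx _ (by omega), aux_second' j x hx _ (by omega) _ _ _ (by omega)]
    linear_combination p * aux_joint g hg0 j x hx (j + 1) b c j (j + 1)
      + (1 - p) * aux_joint g hg0 j x hx (j + 1) b c j (j - 1)
      + p * aux_rate_cyl g j x (j + 1) b c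
  · intro i hi
    rw [aux_zero j x hx, aux_rate g j x hx i hi]
    linear_combination p * aux_joint g hg0 j x hx (j + 1) b c i (i + 1)
      + (1 - p) * aux_joint g hg0 j x hx (j + 1) b c i (i - 1)

theorem aux_LN_left (p : ℝ) (g : ℕ → ℝ) (hg0 : g 0 = 0) (j : ℤ) (x : ConfN × ConfN)
    (hx : ∀ i, x.2 i = x.1 i + if i = j then 1 else 0) (b c : ℕ) :
    LN p g ((auxCyl j (j - 1) (b, b) (c, c + 1)).indicator fun _ => (1 : ℝ)) x
      = (1 - p) * (g (b + 1) - g b) *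
        (auxCyl j (j - 1) (b, b + 1) (c, c)).indicator (fun _ => (1 : ℝ)) x := by
  unfold LN
  rw [tsum_eq_single j]
  · rw [aux_zero j x hx, aux_second j x hx _ (by omega), aux_second' j x hx _ (by omega) _ _ _ (by omega)]
    linear_combination p * aux_joint g hg0 j x hx (j - 1) b c j (j + 1)
      + (1 - p) * aux_joint g hg0 j x hx (j - 1) b c j (j - 1)
      + (1 - p) * aux_rate_cyl g j x (j - 1) b c
  · intro i hi
    rw [aux_zero j x hx, aux_rate g j x hx i hi]
    linear_combination p * aux_joint g hg0 j x hx (j - 1) b c i (i + 1)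
      + (1 - p) * aux_joint g hg0 j x hx (j - 1) b c i (i - 1)

/-- The stay computation on configurations whose value at `j` exceeds `b`. -/
theorem aux_LN_stay (p : ℝ) (g : ℕ → ℝ) (j : ℤ) (x : ConfN × ConfN)
    (hx : ∀ i, x.2 i = x.1 i + if i = j then 1 else 0) (b : ℕ) (hb : b < x.1 j) :
    LN p g ((auxCyl j j (b, b + 1) (b, b + 1)).indicator fun _ => (1 : ℝ)) x
      = g (b + 1) *
        (auxCyl j j (b + 1, b + 2) (b + 1, b + 2)).indicator (fun _ => (1 : ℝ)) x := by
  have hj := hx j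
  simp only [if_true] at hj
  have hz : (auxCyl j j (b, b + 1) (b, b + 1)).indicator (fun _ => (1 : ℝ)) x = 0 := by
    rw [Set.indicator_of_notMem]
    rintro ⟨h1, -⟩
    simp only [Prod.mk.injEq] at h1
    omega
  have hs : ∀ i k, (auxCyl j j (b, b + 1) (b, b + 1)).indicator (fun _ => (1 : ℝ))
      (x.1, moveN x.2 i k) = 0 := by
    intro i k
    rw [Set.indicator_of_notMem]
    rintro ⟨h1, -⟩
    simp only [Prod.mk.injEq] at h1
    omega
  have hm : ∀ i k, i ≠ j → (auxCyl j j (b, b + 1) (b, b + 1)).indicator (fun _ => (1 : ℝ))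
      (moveN x.1 i k, moveN x.2 i k) = 0 := by
    intro i k hi
    rw [Set.indicator_of_notMem]
    rintro ⟨h1, -⟩
    simp only [moveN, Prod.mk.injEq] at h1
    grind
  have hd : ∀ k, g (x.1 j) * (auxCyl j j (b, b + 1) (b, b + 1)).indicator (fun _ => (1 : ℝ))
      (moveN x.1 j k, moveN x.2 j k) = g (b + 1) *
        (auxCyl j j (b + 1, b + 2) (b + 1, b + 2)).indicator (fun _ => (1 : ℝ)) x := by
    intro k
    by_cases h : x.1 j = b + 1
    · rw [Set.indicator_of_mem, Set.indicator_of_mem, h]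
      · simp [auxCyl, h, hj]
      · simp [auxCyl, moveN, h, hj]
    · rw [Set.indicator_of_notMem, Set.indicator_of_notMem]
      · simp
      · simp [auxCyl, h]
      · simp [auxCyl, moveN]; omega
  unfold LN
  rw [tsum_eq_single j]
  · rw [hz, hs, hs]
    linear_combination p * hd (j + 1) + (1 - p) * hd (j - 1)
  · intro i hi
    rw [hz, hs, hs, hm _ _ hi, hm _ _ hi]
    ring

/-- Necessity, partially asymmetric case (`0 < p < 1`): if the single-shock measure satisfies
the random walking shock property with some rates `P, Q ≥ 0`, then `θ = σ`, `μ̂ = μ^θ`, `g` is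
linear with slope `𝔞 = g(1) > 0`, and `P = p·𝔞`, `Q = (1-p)·𝔞`. -/
theorem rws_necessity_partially_asymmetric
    (g : ℕ → ℝ) (hmono : Monotone g) (hg0 : g 0 = 0)
    (hgpos : ∀ z : ℕ, 1 ≤ z → 0 < g z)
    (hgnc : ∃ y₁ y₂ : ℕ, 1 ≤ y₁ ∧ 1 ≤ y₂ ∧ g y₁ ≠ g y₂)
    (p : ℝ) (hp0 : 0 < p) (hp1 : p < 1)
    (θ σ : ℝ)
    (hZθ : Summable fun z : ℕ => exp (θ * z) / gfact g z)
    (hZσ : Summable fun z : ℕ => exp (σ * z) / gfact g z)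
    (μhat : ℕ → ℝ) (hμhat : (∀ y : ℕ, 0 ≤ μhat y) ∧ (∑' y : ℕ, μhat y) = 1)
    (P Q : ℝ) (hP : 0 ≤ P) (hQ : 0 ≤ Q)
    (ν : ℤ → Measure (ConfN × ConfN))
    (hν : ∀ j : ℤ, IsProductMeasure (shockFactor g θ σ μhat j) (ν j))
    (j : ℤ)
    (hRWS : ∀ φ : ConfN × ConfN → ℝ, IsBddCylinder φ →
      ∫ x, LN p g φ x ∂(ν j)
        = P * ((∫ x, φ x ∂(ν (j + 1))) - ∫ x, φ x ∂(ν j))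
          + Q * ((∫ x, φ x ∂(ν (j - 1))) - ∫ x, φ x ∂(ν j))) :
    θ = σ ∧ (∀ z : ℕ, μhat z = muN g θ z) ∧
      (∀ y : ℕ, g y = g 1 * y) ∧ 0 < g 1 ∧ P = p * g 1 ∧ Q = (1 - p) * g 1 := by
  have hgp : ∀ z : ℕ, 1 ≤ z → 0 < g z := hgpos
  have h1pos := aux_muN_pos g hgp θ hZθ
  have h2pos := aux_muN_pos g hgp σ hZσ
  obtain ⟨hm0, hm1⟩ := hμhat
  have hms : Summable μhat := by
    by_contra h
    rw [tsum_eq_zero_of_not_summable h] at hm1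
    exact zero_ne_one hm1
  have hae := aux_shock_ae g θ σ μhat j (ν j) (hν j)
  -- site masses
  have fL : ∀ k i : ℤ, i < k → ∀ a b : ℕ, (shockFactor g θ σ μhat k i {(a, b)}).toReal
      = if b = a then muN g θ a else 0 := by
    intro k i hi a b
    unfold shockFactor
    rw [if_pos hi, aux_site_singleton]
    dsimp only
    split_ifs
    · exact (h1pos a).le
    · exact le_rfl
  have fM : ∀ k a b, (shockFactor g θ σ μhat k k {(a, b)}).toReal
      = if b = a + 1 then μhat a else 0 := by
    intro k a b
    unfold shockFactor
    rw [if_neg (lt_irrefl k), if_pos rfl, aux_site_singleton]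
    dsimp only
    split_ifs
    · exact hm0 a
    · exact le_rfl
  have fR : ∀ k i : ℤ, k < i → ∀ a b : ℕ, (shockFactor g θ σ μhat k i {(a, b)}).toReal
      = if b = a then muN g σ a else 0 := by
    intro k i hi a b
    unfold shockFactor
    rw [if_neg (by omega), if_neg (by omega), aux_site_singleton]
    dsimp only
    split_ifs
    · exact (h2pos a).le
    · exact le_rfl
  have hR : ∀ b c : ℕ, p * (g (b + 1) - g b) * (μhat b * muN g σ c)
      = P * (muN g θ b * μhat c) := by
    intro b c
    have h := hRWS _ (aux_cyl_bdd j (j + 1) (b, b) (c, c + 1))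
    rw [integral_congr_ae (hae.mono fun x hx => aux_LN_right p g hg0 j x hx b c),
      integral_const_mul, aux_cyl_prob _ _ (hν j) _ _ (by omega),
      aux_cyl_prob _ _ (hν j) _ _ (by omega), aux_cyl_prob _ _ (hν (j + 1)) _ _ (by omega),
      aux_cyl_prob _ _ (hν (j - 1)) _ _ (by omega), fM, fM, fM,
      fR j (j + 1) (by omega), fR j (j + 1) (by omega), fR (j - 1) (j + 1) (by omega),
      fL (j + 1) j (by omega)] at h
    simpa using h
  have hL : ∀ b c : ℕ, (1 - p) * (g (b + 1) - g b) * (μhat b * muN g θ c)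
      = Q * (muN g σ b * μhat c) := by
    intro b c
    have h := hRWS _ (aux_cyl_bdd j (j - 1) (b, b) (c, c + 1))
    rw [integral_congr_ae (hae.mono fun x hx => aux_LN_left p g hg0 j x hx b c),
      integral_const_mul, aux_cyl_prob _ _ (hν j) _ _ (by omega),
      aux_cyl_prob _ _ (hν j) _ _ (by omega), aux_cyl_prob _ _ (hν (j + 1)) _ _ (by omega),
      aux_cyl_prob _ _ (hν (j - 1)) _ _ (by omega), fM, fM, fM,
      fL j (j - 1) (by omega), fL j (j - 1) (by omega), fL (j + 1) (j - 1) (by omega),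
      fR (j - 1) j (by omega)] at h
    simpa using h
  have hR' : ∀ b, p * (g (b + 1) - g b) * μhat b = P * muN g θ b := by
    intro b
    have h : ∑' c, p * (g (b + 1) - g b) * μhat b * muN g σ c
        = ∑' c, P * muN g θ b * μhat c := by
      congr 1; funext c; linear_combination hR b c
    rw [tsum_mul_left, tsum_mul_left, hm1, aux_muN_tsum g hgp σ hZσ] at h
    linarith
  have hL' : ∀ b, (1 - p) * (g (b + 1) - g b) * μhat b = Q * muN g σ b := by
    intro b
    have h : ∑' c, (1 - p) * (g (b + 1) - g b) * μhat b * muN g θ c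
        = ∑' c, Q * muN g σ b * μhat c := by
      congr 1; funext c; linear_combination hL b c
    rw [tsum_mul_left, tsum_mul_left, hm1, aux_muN_tsum g hgp θ hZθ] at h
    linarith
  have hq : 0 < 1 - p := by linarith
  have hg1 := hgp 1 le_rfl
  have hPpos : 0 < P := by
    rcases hP.lt_or_eq with h | h
    · exact h
    exfalso
    have hμ0 : μhat 0 = 0 := by
      have := hR' 0
      rw [← h, zero_add, hg0, sub_zero, zero_mul] at this
      rcases mul_eq_zero.mp this with h' | h'
      · exact absurd h' (mul_pos hp0 hg1).ne'
      · exact h'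
    have hQ0 : Q = 0 := by
      have := hL' 0
      rw [hμ0, mul_zero] at this
      rcases mul_eq_zero.mp this.symm with h' | h'
      · exact h'
      · exact absurd h' (h2pos 0).ne'
    have hall : ∀ b, μhat b = 0 := by
      intro b
      induction b using Nat.strong_induction_on with
      | _ b ih =>
        rcases b with _ | b
        · exact hμ0
        have hae2 : ∀ᵐ x ∂(ν j), ∀ k ∈ Finset.range (b + 1),
            x ∉ auxCyl j j (k, k + 1) (k, k + 1) := by
          rw [Filter.eventually_all_finset]
          intro k hk
          rw [ae_iff]
          simp only [not_not]
          change ν j (auxCyl j j (k, k + 1) (k, k + 1)) = 0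
          rw [aux_cyl_prob1 _ _ (hν j)]
          unfold shockFactor
          rw [if_neg (lt_irrefl j), if_pos rfl]
          apply aux_site_zero
          intro u hu
          rw [Set.mem_singleton_iff] at hu
          subst hu
          simp [ih k (Finset.mem_range.mp hk)]
        have hst := hRWS _ (aux_cyl_bdd j j (b, b + 1) (b, b + 1))
        rw [integral_congr_ae (g := fun x => g (b + 1) *
          (auxCyl j j (b + 1, b + 2) (b + 1, b + 2)).indicator (fun _ => (1 : ℝ)) x)
          (by
            filter_upwards [hae, hae2] with x hx hx2
            apply aux_LN_stay p g j x hx b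
            by_contra hlt
            have hj := hx j
            simp only [if_true] at hj
            exact hx2 (x.1 j) (Finset.mem_range.mpr (by omega)) (by simp [auxCyl, hj])),
          integral_const_mul, integral_indicator (aux_cyl_meas _ _ _ _), ← h, hQ0] at hst
        simp [Measure.real, aux_cyl_prob1 _ _ (hν j), fM] at hst
        rcases hst with h' | h'
        · exact absurd h' (hgp (b + 1) (by omega)).ne'
        · exact h'
    simp [hall] at hm1
  have hinc : ∀ b, 0 < g (b + 1) - g b ∧ 0 < μhat b := by
    intro b
    have h := hR' b
    have h3 : 0 < p * (g (b + 1) - g b) * μhat b := h ▸ mul_pos hPpos (h1pos b)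
    have h4 : 0 ≤ g (b + 1) - g b := sub_nonneg.mpr (hmono (Nat.le_succ b))
    refine ⟨h4.lt_of_ne ?_, (hm0 b).lt_of_ne ?_⟩
    · intro h5; rw [← h5] at h3; simp at h3
    · intro h5; rw [← h5] at h3; simp at h3
  have hQpos : 0 < Q := by
    have h3 : 0 < Q * muN g σ 0 := hL' 0 ▸ mul_pos (mul_pos hq (hinc 0).1) (hinc 0).2
    exact pos_of_mul_pos_left h3 (h2pos 0).le
  have e2 : ∀ c, μhat c = muN g σ c := by
    intro c
    have h : P * muN g θ 0 * μhat c = P * muN g θ 0 * muN g σ c := by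
      linear_combination muN g σ c * hR' 0 - hR 0 c
    exact mul_left_cancel₀ (mul_pos hPpos (h1pos 0)).ne' h
  have e1 : ∀ c, μhat c = muN g θ c := by
    intro c
    have h : Q * muN g σ 0 * μhat c = Q * muN g σ 0 * muN g θ c := by
      linear_combination muN g θ c * hL' 0 - hL 0 c
    exact mul_left_cancel₀ (mul_pos hQpos (h2pos 0)).ne' h
  have hPg : ∀ b, p * (g (b + 1) - g b) = P := by
    intro b
    have h := hR' b
    rw [← e1 b] at h
    exact mul_right_cancel₀ (hinc b).2.ne' h
  have hQg : (1 - p) * (g (0 + 1) - g 0) = Q := by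
    have h := hL' 0
    rw [← e2 0] at h
    exact mul_right_cancel₀ (hinc 0).2.ne' h
  have hPv : P = p * g 1 := by
    have h := hPg 0
    rw [zero_add, hg0, sub_zero] at h
    exact h.symm
  refine ⟨aux_muN_inj g hgp θ σ hZθ fun z => (e1 z).symm.trans (e2 z), e1, ?_, hg1, hPv, ?_⟩
  · intro y
    induction y with
    | zero => simp [hg0]
    | succ b ih =>
      have h := hPg b
      rw [hPv] at h
      have h' := mul_left_cancel₀ hp0.ne' h
      push_cast
      linarith
  · rw [zero_add, hg0, sub_zero] at hQg
    exact hQg.symm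
end
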